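/- arXiv:0802.1414 — 2 statements merged into one kernel-verified Lean document; each statement's English description precedes it below -/
import Mathlib

section
/- Fix h₀>0 and R>0, and let E₀ be the corresponding constant from the localization lemma (i.e. the one such that for every E>E₀ there is α_E>0 with: α∈(0,α_E), h∈(0,h₀), Re z<−E₀ and |q(z,h)+α^{−1}| ≤ R|a(z,h)| imply Re z<−E and |Im z|<4h₀). Then there exists α₀>0 such that for every h∈(0,h₀) and every α∈(0,α₀) there is a function ζ defined on {μ∈ℂ: |μ|<R}, holomorphic in μ, such that for each such μ the point z=ζ(μ) is the unique z∈ℂ with Re z<−E₀ satisfying the equation q(z,h)+α^{−1} = μ·a(z,h); moreover ζ(μ) is real whenever μ is real. -/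
open MeasureTheory Real Set

/-- Modulus of the Landau heat kernel at distance `r`. -/
noncomputable def landauHeatKernel (h r t : ℝ) : ℝ :=
  h / (4 * π * Real.sinh (h * t)) *
    Real.exp (-(h * r ^ 2 * (Real.cosh (h * t) / Real.sinh (h * t))) / 4)

/-- `F_h(r,z) = ∫₀^∞ e^{zt} p_h(r,t) dt`, in modulus the Green function of the Landau
Hamiltonian at distance `r`. -/
noncomputable def landauGreen (h r : ℝ) (z : ℂ) : ℂ :=
  ∫ t in Ioi (0 : ℝ), Complex.exp (z * t) * ((landauHeatKernel h r t : ℝ) : ℂ)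

/-- Regularized diagonal value of the free Green function:
`q_0(z) = −(Log(−z) − log 4 + 2γ)/(4π)`. -/
noncomputable def q0 (z : ℂ) : ℂ :=
  -(Complex.log (-z) - Real.log 4 + 2 * Real.eulerMascheroniConstant) / (4 * π)

/-- Regularized diagonal value of the Green function of the Landau Hamiltonian:
`q(z,h) = q_0(z) + ∫₀^∞ e^{zt} (1/(4π))(h/sinh(ht) − 1/t) dt`. -/
noncomputable def qDiag (h : ℝ) (z : ℂ) : ℂ :=
  q0 z + ∫ t in Ioi (0 : ℝ),
    Complex.exp (z * t) * (((1 / (4 * π)) * (h / Real.sinh (h * t) - 1 / t) : ℝ) : ℂ)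

/-- `a(z,h) = 2 F_h(1,z)`, twice the Green function at nearest-neighbour lattice points. -/
noncomputable def aCoeff (h : ℝ) (z : ℂ) : ℂ := 2 * landauGreen h 1 z

/-- The Laplace integral `∫₀^∞ e^{zt} k(t) dt` of a real kernel. -/
noncomputable def laplaceIntegral (k : ℝ → ℝ) (z : ℂ) : ℂ :=
  ∫ t in Ioi (0 : ℝ), Complex.exp (z * t) * ((k t : ℝ) : ℂ)

lemma integrableOn_exp_neg_Ioi_zero {c : ℝ} (hc : 0 < c) :
    IntegrableOn (fun t : ℝ => Real.exp (-c * t)) (Ioi 0) :=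
  integrableOn_exp_mul_Ioi (by linarith) 0

lemma integrableOn_mul_exp_neg_Ioi_zero {c : ℝ} (hc : 0 < c) :
    IntegrableOn (fun t : ℝ => t * Real.exp (-c * t)) (Ioi 0) := by
  simpa using integrableOn_rpow_mul_exp_neg_mul_rpow (p := 1) (s := 1) (by norm_num) one_pos hc

lemma integral_mul_exp_neg_Ioi_zero {c : ℝ} (hc : 0 < c) :
    ∫ t in Ioi (0 : ℝ), t * Real.exp (-c * t) = 1 / c ^ 2 := by
  have := Real.integral_rpow_mul_exp_neg_mul_Ioi (a := 2) (by norm_num) hc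
  norm_num [show (2 : ℝ) - 1 = 1 by norm_num] at this
  simpa using this

lemma norm_exp_mul_kernel (k : ℝ → ℝ) (z : ℂ) (t : ℝ) :
    ‖Complex.exp (z * t) * ((k t : ℝ) : ℂ)‖ = |k t| * Real.exp (z.re * t) := by
  simp [Complex.norm_exp, mul_comm]

section LaplaceIntegral

variable {k : ℝ → ℝ} {M : ℝ}

lemma norm_laplaceIntegral_le (hM : ∀ t > 0, |k t| ≤ M) {z : ℂ} (hz : z.re < 0) :
    ‖laplaceIntegral k z‖ ≤ M / (-z.re) := by
  have hc : 0 < -z.re := by linarith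
  have hbound : ∀ᵐ t : ℝ ∂(volume.restrict (Ioi (0 : ℝ))),
      ‖Complex.exp (z * t) * ((k t : ℝ) : ℂ)‖ ≤ M * Real.exp (-(-z.re) * t) := by
    filter_upwards [ae_restrict_mem measurableSet_Ioi] with t ht
    rw [norm_exp_mul_kernel, neg_neg]
    exact mul_le_mul_of_nonneg_right (hM t ht) (Real.exp_pos _).le
  refine (norm_integral_le_of_norm_le
    ((integrableOn_exp_neg_Ioi_zero hc).const_mul M) hbound).trans_eq ?_
  rw [integral_const_mul, integral_exp_mul_Ioi (by linarith)]
  simp [div_eq_mul_inv]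

lemma exists_hasDerivAt_laplaceIntegral (hk : Measurable k) (hM : ∀ t > 0, |k t| ≤ M)
    {z : ℂ} (hz : z.re < 0) :
    ∃ d : ℂ, HasDerivAt (laplaceIntegral k) d z ∧ ‖d‖ ≤ M / z.re ^ 2 := by
  have hc : 0 < -z.re := by linarith
  have hmeas : ∀ w : ℂ, Measurable fun t : ℝ => Complex.exp (w * t) * ((k t : ℝ) : ℂ) := by
    intro w; fun_prop
  have hs : {w : ℂ | w.re < z.re / 2} ∈ nhds z :=
    (isOpen_lt Complex.continuous_re continuous_const).mem_nhds (by simp; linarith)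
  have hnorm : ∀ t : ℝ, 0 < t → ∀ w : ℂ,
      ‖(t : ℂ) * (Complex.exp (w * t) * ((k t : ℝ) : ℂ))‖ ≤ M * (t * Real.exp (w.re * t)) := by
    intro t ht w
    rw [norm_mul, norm_exp_mul_kernel, Complex.norm_real, Real.norm_eq_abs, abs_of_pos ht]
    have := mul_le_mul_of_nonneg_right (hM t ht) (mul_pos ht (Real.exp_pos (w.re * t))).le
    linarith
  have key := hasDerivAt_integral_of_dominated_loc_of_deriv_le
    (μ := volume.restrict (Ioi (0 : ℝ)))
    (F := fun (w : ℂ) (t : ℝ) => Complex.exp (w * t) * ((k t : ℝ) : ℂ))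
    (F' := fun (w : ℂ) (t : ℝ) => (t : ℂ) * (Complex.exp (w * t) * ((k t : ℝ) : ℂ)))
    (bound := fun t => M * (t * Real.exp (-(-z.re / 2) * t)))
    hs (Filter.Eventually.of_forall fun w => (hmeas w).aestronglyMeasurable)
    (((integrableOn_exp_neg_Ioi_zero hc).const_mul M).mono' (hmeas z).aestronglyMeasurable (by
      filter_upwards [ae_restrict_mem measurableSet_Ioi] with t ht
      rw [norm_exp_mul_kernel, neg_neg]
      exact mul_le_mul_of_nonneg_right (hM t ht) (Real.exp_pos _).le))
    (Measurable.aestronglyMeasurable (by fun_prop))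
    (by
      filter_upwards [ae_restrict_mem measurableSet_Ioi] with t ht w hw
      have ht' : (0 : ℝ) < t := ht
      have hw' : w.re < z.re / 2 := hw
      have hM0 : 0 ≤ M := (abs_nonneg _).trans (hM t ht)
      refine (hnorm t ht w).trans ?_
      gcongr
      linarith)
    ((integrableOn_mul_exp_neg_Ioi_zero (by linarith)).const_mul M)
    (Filter.Eventually.of_forall fun t w _ => by
      have := ((((hasDerivAt_id w).mul_const (t : ℂ)).cexp).mul_const ((k t : ℝ) : ℂ))
      convert! this using 1
      simp; ring)
  refine ⟨_, key.2, ?_⟩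
  have hbound : ∀ᵐ t : ℝ ∂(volume.restrict (Ioi (0 : ℝ))),
      ‖(t : ℂ) * (Complex.exp (z * t) * ((k t : ℝ) : ℂ))‖
        ≤ M * (t * Real.exp (-(-z.re) * t)) := by
    filter_upwards [ae_restrict_mem measurableSet_Ioi] with t ht
    simpa using hnorm t ht z
  refine (norm_integral_le_of_norm_le
    ((integrableOn_mul_exp_neg_Ioi_zero hc).const_mul M) hbound).trans_eq ?_
  rw [integral_const_mul, integral_mul_exp_neg_Ioi_zero hc]
  simp [div_eq_mul_inv]

lemma laplaceIntegral_conj (k : ℝ → ℝ) (z : ℂ) :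
    laplaceIntegral k (starRingEnd ℂ z) = starRingEnd ℂ (laplaceIntegral k z) := by
  unfold laplaceIntegral
  rw [← integral_conj]
  congr 1 with t
  simp [← Complex.exp_conj]

end LaplaceIntegral

/-- A family of `1/2`-contractions of a closed ball which preserves holomorphy in the parameter
has a holomorphic family of fixed points. -/
lemma exists_differentiableOn_fixedPoint {U : Set ℂ} (hU : IsOpen U) {c : ℂ} {r : ℝ} (hr : 0 ≤ r)
    (T : ℂ → ℂ → ℂ)
    (hmaps : ∀ μ ∈ U, ∀ z ∈ Metric.closedBall c r, T μ z ∈ Metric.closedBall c r)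
    (hcontr : ∀ μ ∈ U, ∀ z ∈ Metric.closedBall c r, ∀ w ∈ Metric.closedBall c r,
      dist (T μ z) (T μ w) ≤ 1 / 2 * dist z w)
    (hdiff : ∀ g : ℂ → ℂ, DifferentiableOn ℂ g U → (∀ μ ∈ U, g μ ∈ Metric.closedBall c r) →
      DifferentiableOn ℂ (fun μ => T μ (g μ)) U) :
    ∃ ζ : ℂ → ℂ, DifferentiableOn ℂ ζ U ∧
      ∀ μ ∈ U, ζ μ ∈ Metric.closedBall c r ∧ T μ (ζ μ) = ζ μ := by
  let g : ℕ → ℂ → ℂ := fun n μ => (T μ)^[n] c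
  have gsucc : ∀ n μ, g (n + 1) μ = T μ (g n μ) := fun n μ => Function.iterate_succ_apply' _ _ _
  have gmem : ∀ n, ∀ μ ∈ U, g n μ ∈ Metric.closedBall c r := by
    intro n μ hμ
    induction n with
    | zero => simpa [g] using hr
    | succ n ih => rw [gsucc]; exact hmaps μ hμ _ ih
  have gdiff : ∀ n, DifferentiableOn ℂ (g n) U := by
    intro n
    induction n with
    | zero => exact differentiableOn_const c
    | succ n ih => exact (hdiff _ ih (gmem n)).congr fun μ _ => gsucc n μ
  have gdist : ∀ μ ∈ U, ∀ n, dist (g n μ) (g (n + 1) μ) ≤ r * (1 / 2) ^ n := by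
    intro μ hμ n
    induction n with
    | zero => simpa [dist_comm, g] using gmem 1 μ hμ
    | succ n ih =>
      have := hcontr μ hμ _ (gmem n μ hμ) _ (gmem (n + 1) μ hμ)
      rw [← gsucc, ← gsucc] at this
      rw [pow_succ]
      linarith
  have hlim : ∀ μ, ∃ l, μ ∈ U → Filter.Tendsto (fun n => g n μ) Filter.atTop (nhds l) := by
    intro μ
    by_cases hμ : μ ∈ U
    · obtain ⟨l, hl⟩ := cauchySeq_tendsto_of_complete
        (cauchySeq_of_le_geometric (1 / 2) r (by norm_num) (gdist μ hμ))
      exact ⟨l, fun _ => hl⟩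
    · exact ⟨0, fun h => absurd h hμ⟩
  choose ζ hζ using hlim
  have hunif : TendstoUniformlyOn g ζ Filter.atTop U := by
    rw [Metric.tendstoUniformlyOn_iff]
    intro ε hε
    have h0 : Filter.Tendsto (fun n : ℕ => r * (1 / 2 : ℝ) ^ n / (1 - 1 / 2)) Filter.atTop
        (nhds 0) := by
      simpa using ((tendsto_pow_atTop_nhds_zero_of_lt_one (r := (1 / 2 : ℝ)) (by norm_num)
        (by norm_num)).const_mul r).div_const (1 - 1 / 2)
    filter_upwards [h0.eventually_lt_const hε] with n hn μ hμ
    rw [dist_comm]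
    exact (dist_le_of_le_geometric_of_tendsto (1 / 2) r (by norm_num) (gdist μ hμ)
      (hζ μ hμ) n).trans_lt hn
  refine ⟨ζ, hunif.tendstoLocallyUniformlyOn.differentiableOn
    (Filter.Eventually.of_forall gdiff) hU, fun μ hμ => ?_⟩
  have hmem : ζ μ ∈ Metric.closedBall c r :=
    Metric.isClosed_closedBall.mem_of_tendsto (hζ μ hμ)
      (Filter.Eventually.of_forall fun n => gmem n μ hμ)
  refine ⟨hmem, tendsto_nhds_unique ?_ ((Filter.tendsto_add_atTop_iff_nat 1).2 (hζ μ hμ))⟩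
  simp only [gsucc]
  rw [tendsto_iff_dist_tendsto_zero]
  refine squeeze_zero (fun _ => dist_nonneg)
    (fun n => hcontr μ hμ _ (gmem n μ hμ) _ hmem) ?_
  simpa only [mul_zero] using
    (tendsto_iff_dist_tendsto_zero.1 (hζ μ hμ)).const_mul (1 / 2)

lemma self_sub_le_mul_sinh {x : ℝ} (hx : 0 < x) : Real.sinh x - x ≤ x * Real.sinh x := by
  have hs : 0 < Real.sinh x := Real.sinh_pos_iff.2 hx
  rcases le_or_gt 1 x with h | h
  · nlinarith
  · have h1 : Real.sinh x ≤ Real.exp x - 1 := by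
      rw [← Real.cosh_add_sinh]; linarith [Real.one_le_cosh x]
    have h2 : Real.exp x * (1 - x) ≤ 1 := by
      have h3 := Real.add_one_le_exp (-x)
      have h4 : Real.exp x * Real.exp (-x) = 1 := by rw [← Real.exp_add]; simp
      nlinarith [Real.exp_pos x]
    nlinarith

/-- The kernel of the difference between the Landau and the free regularized diagonals. -/
noncomputable def diagKernel (h t : ℝ) : ℝ := (1 / (4 * π)) * (h / Real.sinh (h * t) - 1 / t)

lemma measurable_diagKernel (h : ℝ) : Measurable (diagKernel h) := by
  unfold diagKernel; fun_prop

lemma measurable_landauHeatKernel (h r : ℝ) : Measurable (landauHeatKernel h r) := by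
  unfold landauHeatKernel; fun_prop

lemma abs_diagKernel_le {h t : ℝ} (hh : 0 < h) (ht : 0 < t) :
    |diagKernel h t| ≤ h / (4 * π) := by
  have hx : 0 < h * t := mul_pos hh ht
  have hs : 0 < Real.sinh (h * t) := Real.sinh_pos_iff.2 hx
  have h1 := self_sub_le_mul_sinh hx
  have h2 : h * t ≤ Real.sinh (h * t) := Real.self_le_sinh_iff.2 hx.le
  have key : |h / Real.sinh (h * t) - 1 / t| ≤ h := by
    have e : h / Real.sinh (h * t) - 1 / t
        = (h * t - Real.sinh (h * t)) / (Real.sinh (h * t) * t) := by field_simp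
    rw [e, abs_div, abs_of_pos (mul_pos hs ht), div_le_iff₀ (mul_pos hs ht),
      abs_of_nonpos (by linarith)]
    linarith
  unfold diagKernel
  rw [abs_mul, abs_of_pos (by positivity), div_mul_eq_mul_div, one_mul]
  gcongr

lemma abs_landauHeatKernel_one_le {h t : ℝ} (hh : 0 < h) (ht : 0 < t) :
    |landauHeatKernel h 1 t| ≤ 1 / π := by
  have hs : 0 < Real.sinh (h * t) := Real.sinh_pos_iff.2 (mul_pos hh ht)
  set s := h / Real.sinh (h * t) with hsdef
  have hs0 : 0 < s := div_pos hh hs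
  have e : landauHeatKernel h 1 t = 1 / π * (s / 4 * Real.exp (-(s / 4 * Real.cosh (h * t)))) := by
    unfold landauHeatKernel
    rw [hsdef, ← mul_assoc]
    congr 1
    · field_simp
    · congr 1
      ring
  rw [e, abs_of_pos (by positivity)]
  have h1 : Real.exp (-(s / 4 * Real.cosh (h * t))) ≤ Real.exp (-(s / 4)) := by
    gcongr
    nlinarith [Real.one_le_cosh (h * t)]
  have h2 : s / 4 * Real.exp (-(s / 4)) ≤ 1 := by
    rw [Real.exp_neg, ← div_eq_mul_inv, div_le_one (Real.exp_pos _)]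
    linarith [Real.add_one_le_exp (s / 4)]
  have h3 : s / 4 * Real.exp (-(s / 4 * Real.cosh (h * t))) ≤ 1 :=
    (mul_le_mul_of_nonneg_left h1 (by positivity)).trans h2
  simpa using mul_le_mul_of_nonneg_left h3 (show 0 ≤ 1 / π by positivity)

/-- The correction `Φ` in the logarithmic form `Log(−z) = L + Φ` of the equation
`q(z,h) + α⁻¹ = μ a(z,h)`; see `qDiag_add_inv_eq_iff`. -/
noncomputable def logCorrection (h : ℝ) (μ z : ℂ) : ℂ :=
  4 * π * (laplaceIntegral (diagKernel h) z - μ * aCoeff h z)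

lemma aCoeff_eq (h : ℝ) (z : ℂ) : aCoeff h z = 2 * laplaceIntegral (landauHeatKernel h 1) z := rfl

lemma norm_four_pi_mul_sub_le {h h₀ R x : ℝ} {μ u v : ℂ} (hh : h ≤ h₀) (hμ : ‖μ‖ ≤ R)
    (hx : 0 < x) (hu : ‖u‖ ≤ h / (4 * π) / x) (hv : ‖v‖ ≤ 1 / π / x) :
    ‖4 * π * (u - μ * (2 * v))‖ ≤ (h₀ + 8 * R) / x := by
  have h1 : ‖u - μ * (2 * v)‖ ≤ h / (4 * π) / x + R * (2 * (1 / π / x)) := by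
    refine (norm_sub_le _ _).trans (add_le_add hu ?_)
    rw [norm_mul, norm_mul, Complex.norm_ofNat]
    have : 0 ≤ R := (norm_nonneg μ).trans hμ
    gcongr
  rw [norm_mul]
  have h2 : ‖(4 * π : ℂ)‖ = 4 * π := by simp [abs_of_pos Real.pi_pos]
  rw [h2]
  calc 4 * π * ‖u - μ * (2 * v)‖
      ≤ 4 * π * (h / (4 * π) / x + R * (2 * (1 / π / x))) := by gcongr
    _ = (h + 8 * R) / x := by field_simp; ring
    _ ≤ (h₀ + 8 * R) / x := by gcongr

section LogCorrection

variable {h h₀ R : ℝ} {μ z : ℂ}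

lemma norm_logCorrection_le (hh : 0 < h) (hh₀ : h ≤ h₀) (hμ : ‖μ‖ ≤ R) (hz : z.re < 0) :
    ‖logCorrection h μ z‖ ≤ (h₀ + 8 * R) / (-z.re) :=
  norm_four_pi_mul_sub_le hh₀ hμ (by linarith)
    (norm_laplaceIntegral_le (fun _ ht => abs_diagKernel_le hh ht) hz)
    (norm_laplaceIntegral_le (fun _ ht => abs_landauHeatKernel_one_le hh ht) hz)

lemma exists_hasDerivAt_logCorrection (hh : 0 < h) (hh₀ : h ≤ h₀) (hμ : ‖μ‖ ≤ R)
    (hz : z.re < 0) :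
    ∃ d : ℂ, HasDerivAt (logCorrection h μ) d z ∧ ‖d‖ ≤ (h₀ + 8 * R) / z.re ^ 2 := by
  obtain ⟨u, hu, hu'⟩ := exists_hasDerivAt_laplaceIntegral (measurable_diagKernel h)
    (fun _ ht => abs_diagKernel_le hh ht) hz
  obtain ⟨v, hv, hv'⟩ := exists_hasDerivAt_laplaceIntegral (measurable_landauHeatKernel h 1)
    (fun _ ht => abs_landauHeatKernel_one_le hh ht) hz
  exact ⟨_, (hu.sub ((hv.const_mul 2).const_mul μ)).const_mul (4 * π : ℂ),
    norm_four_pi_mul_sub_le hh₀ hμ (sq_pos_of_neg hz) hu' hv'⟩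

lemma logCorrection_conj (h : ℝ) (μ z : ℂ) :
    logCorrection h (starRingEnd ℂ μ) (starRingEnd ℂ z)
      = starRingEnd ℂ (logCorrection h μ z) := by
  simp only [logCorrection, aCoeff_eq, laplaceIntegral_conj, map_mul, map_sub, map_ofNat,
    Complex.conj_ofReal]

lemma differentiableOn_logCorrection_comp (hh : 0 < h) {U : Set ℂ} {g : ℂ → ℂ}
    (hg : DifferentiableOn ℂ g U) (hneg : ∀ μ ∈ U, (g μ).re < 0) :
    DifferentiableOn ℂ (fun μ => logCorrection h μ (g μ)) U := by
  have comp : ∀ {k : ℝ → ℝ} {M : ℝ}, Measurable k → (∀ t > 0, |k t| ≤ M) →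
      DifferentiableOn ℂ (fun μ => laplaceIntegral k (g μ)) U := fun hk hM μ hμ => by
    obtain ⟨d, hd, -⟩ := exists_hasDerivAt_laplaceIntegral hk hM (hneg μ hμ)
    exact hd.differentiableAt.comp_differentiableWithinAt μ (hg μ hμ)
  exact ((comp (measurable_diagKernel h) fun _ ht => abs_diagKernel_le hh ht).sub
    (differentiableOn_id.mul ((comp (measurable_landauHeatKernel h 1)
      fun _ ht => abs_landauHeatKernel_one_le hh ht).const_mul 2))).const_mul (4 * π : ℂ)

end LogCorrection

/-- The real constant `L` in the logarithmic form of the equation. -/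
noncomputable def logCenter (α : ℝ) : ℝ :=
  4 * π * α⁻¹ + Real.log 4 - 2 * Real.eulerMascheroniConstant

lemma qDiag_add_inv_eq_iff (h α : ℝ) (μ z : ℂ) :
    qDiag h z + ((α⁻¹ : ℝ) : ℂ) = μ * aCoeff h z ↔
      Complex.log (-z) = logCenter α + logCorrection h μ z := by
  have hpi : (π : ℂ) ≠ 0 := by exact_mod_cast Real.pi_ne_zero
  have hq : qDiag h z = q0 z + laplaceIntegral (diagKernel h) z := rfl
  rw [hq, logCorrection, logCenter, q0]
  push_cast
  generalize aCoeff h z = a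
  generalize laplaceIntegral (diagKernel h) z = K
  generalize (α : ℂ)⁻¹ = b
  generalize Complex.log (-z) = l
  generalize (Real.eulerMascheroniConstant : ℂ) = γ
  constructor
  · intro H
    field_simp at H
    linear_combination -H
  · intro H
    field_simp
    linear_combination -H

/-- The solutions of the equation near `−exp (logCenter α)` are the fixed points of this map. -/
noncomputable def expMap (h α : ℝ) (μ z : ℂ) : ℂ :=
  -(Real.exp (logCenter α) : ℂ) * Complex.exp (logCorrection h μ z)

lemma expMap_eq_neg_exp (h α : ℝ) (μ z : ℂ) :
    expMap h α μ z = -Complex.exp (logCenter α + logCorrection h μ z) := by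
  rw [expMap, Complex.exp_add, Complex.ofReal_exp, neg_mul]

lemma expMap_eq_self_of_eq {h α : ℝ} {μ z : ℂ} (hz : z.re < 0)
    (heq : qDiag h z + ((α⁻¹ : ℝ) : ℂ) = μ * aCoeff h z) : expMap h α μ z = z := by
  have hz0 : -z ≠ 0 := by
    rintro h0
    rw [neg_eq_zero.1 h0] at hz
    simp at hz
  rw [expMap_eq_neg_exp, ← (qDiag_add_inv_eq_iff h α μ z).1 heq, Complex.exp_log hz0, neg_neg]

lemma eq_of_expMap_eq_self {h α : ℝ} {μ z : ℂ} (hΦ : ‖logCorrection h μ z‖ ≤ 1)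
    (hfix : expMap h α μ z = z) : qDiag h z + ((α⁻¹ : ℝ) : ℂ) = μ * aCoeff h z := by
  rw [qDiag_add_inv_eq_iff]
  have him := abs_le.1 ((Complex.abs_im_le_norm _).trans hΦ)
  conv_lhs => rw [← hfix]
  rw [expMap_eq_neg_exp, neg_neg, Complex.log_exp]
  · simp; linarith [Real.pi_gt_three]
  · simp; linarith [Real.pi_gt_three]

lemma expMap_conj (h α : ℝ) (μ z : ℂ) :
    expMap h α (starRingEnd ℂ μ) (starRingEnd ℂ z) = starRingEnd ℂ (expMap h α μ z) := by
  simp [expMap_eq_neg_exp, logCorrection_conj, ← Complex.exp_conj, Complex.conj_ofReal]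

section ExpMap

variable {h h₀ R α : ℝ} {μ z : ℂ}

lemma norm_expMap_add_le (hΦ : ‖logCorrection h μ z‖ ≤ 1 / 4) :
    ‖expMap h α μ z + Real.exp (logCenter α)‖ ≤ Real.exp (logCenter α) / 2 := by
  have e : expMap h α μ z + Real.exp (logCenter α)
      = -(Real.exp (logCenter α) : ℂ) * (Complex.exp (logCorrection h μ z) - 1) := by
    rw [expMap]; ring
  have h1 := Complex.norm_exp_sub_one_le (x := logCorrection h μ z) (by linarith)
  rw [e, norm_mul, norm_neg, Complex.norm_real, Real.norm_eq_abs, Real.abs_exp]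
  nlinarith [Real.exp_pos (logCenter α)]

lemma re_le_of_mem_closedBall {A : ℝ} (hz : z ∈ Metric.closedBall (-(A : ℂ)) (A / 2)) :
    z.re ≤ -(A / 2) := by
  have := (abs_le.1 ((Complex.abs_re_le_norm _).trans (mem_closedBall_iff_norm.1 hz))).2
  simp at this
  linarith

lemma norm_logCorrection_le_of_mem_closedBall {A : ℝ} (hh : 0 < h) (hh₀ : h ≤ h₀)
    (hμ : ‖μ‖ ≤ R) (hA₀ : 0 < A) (hA : 24 * (h₀ + 8 * R) ≤ A)
    (hz : z ∈ Metric.closedBall (-(A : ℂ)) (A / 2)) : ‖logCorrection h μ z‖ ≤ 1 / 12 := by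
  have hre := re_le_of_mem_closedBall hz
  refine (norm_logCorrection_le hh hh₀ hμ (by linarith)).trans ?_
  rw [div_le_iff₀ (by linarith)]
  linarith

lemma dist_expMap_le (hh : 0 < h) (hh₀ : h ≤ h₀) (hμ : ‖μ‖ ≤ R)
    (hA : 24 * (h₀ + 8 * R) ≤ Real.exp (logCenter α)) {w : ℂ}
    (hz : z ∈ Metric.closedBall (-(Real.exp (logCenter α) : ℂ)) (Real.exp (logCenter α) / 2))
    (hw : w ∈ Metric.closedBall (-(Real.exp (logCenter α) : ℂ)) (Real.exp (logCenter α) / 2)) :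
    dist (expMap h α μ z) (expMap h α μ w) ≤ 1 / 2 * dist z w := by
  have hd : ∀ x ∈ Metric.closedBall (-(Real.exp (logCenter α) : ℂ))
      (Real.exp (logCenter α) / 2), ∃ d, HasDerivAt (expMap h α μ) d x ∧ ‖d‖ ≤ 1 / 2 := by
    intro x hx
    have hA₀ := Real.exp_pos (logCenter α)
    have hre := re_le_of_mem_closedBall hx
    obtain ⟨d, hd, hd'⟩ := exists_hasDerivAt_logCorrection (z := x) hh hh₀ hμ (by linarith)
    refine ⟨_, hd.cexp.const_mul _, ?_⟩
    have hΦ := norm_logCorrection_le_of_mem_closedBall hh hh₀ hμ hA₀ hA hx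
    rw [norm_mul, norm_mul, norm_neg, Complex.norm_real, Real.norm_eq_abs, Real.abs_exp]
    have hexp : ‖Complex.exp (logCorrection h μ x)‖ ≤ 3 := by
      refine (Complex.norm_exp_le_exp_norm _).trans ?_
      have := Real.exp_le_exp.2 (hΦ.trans (show (1 / 12 : ℝ) ≤ 1 by norm_num))
      linarith [Real.exp_one_lt_d9]
    generalize Real.exp (logCenter α) = A at *
    have hC : 0 ≤ h₀ + 8 * R := by linarith [(norm_nonneg μ).trans hμ]
    have hd'' : ‖d‖ ≤ (h₀ + 8 * R) / (A / 2) ^ 2 := by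
      have hsq : (A / 2) ^ 2 ≤ x.re ^ 2 := by nlinarith
      exact hd'.trans (by gcongr)
    calc A * (‖Complex.exp (logCorrection h μ x)‖ * ‖d‖)
        ≤ A * (3 * ((h₀ + 8 * R) / (A / 2) ^ 2)) := by gcongr
      _ = 12 * (h₀ + 8 * R) / A := by field_simp; ring
      _ ≤ 1 / 2 := by rw [div_le_iff₀ hA₀]; linarith
  choose! d hd using hd
  rw [dist_eq_norm, dist_eq_norm]
  exact (convex_closedBall _ _).norm_image_sub_le_of_norm_hasDerivWithin_le
    (fun x hx => (hd x hx).1.hasDerivWithinAt) (fun x hx => (hd x hx).2) hw hz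

end ExpMap

lemma le_exp_logCenter {α B : ℝ} (hα : 0 < α)
    (hB : α < 4 * π / (|B| + 2 * Real.eulerMascheroniConstant)) :
    B ≤ Real.exp (logCenter α) := by
  have hγ := Real.one_half_lt_eulerMascheroniConstant
  have h1 : |B| + 2 * Real.eulerMascheroniConstant < 4 * π * α⁻¹ := by
    rw [lt_div_iff₀ (by positivity)] at hB
    rw [← div_eq_mul_inv, lt_div_iff₀ hα]
    linarith
  have h2 : 0 ≤ Real.log 4 := Real.log_nonneg (by norm_num)
  have h3 : B ≤ logCenter α := by unfold logCenter; linarith [le_abs_self B]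
  linarith [Real.add_one_le_exp (logCenter α)]

/-- Fix `h₀>0`, `R>0`, and let `E₀>0` be a constant with the localization property.
Then there is `α₀>0` such that for `h∈(0,h₀)` and `α∈(0,α₀)` the equation
`q(z,h)+α⁻¹ = μ a(z,h)` has in `{Re z<−E₀}` a unique solution `z=ζ(μ)` for every `μ`
with `|μ|<R`, `ζ` is holomorphic in `μ` on that disc, and `ζ(μ)` is real for real `μ`. -/
theorem unique_holomorphic_solution
    (h₀ R E₀ : ℝ) (hh₀ : 0 < h₀) (hR : 0 < R) (hE₀ : 0 < E₀)
    (hloc : ∀ E > E₀, ∃ αE > 0, ∀ α ∈ Ioo (0 : ℝ) αE, ∀ h ∈ Ioo (0 : ℝ) h₀, ∀ z : ℂ,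
      z.re < -E₀ → ‖qDiag h z + ((α⁻¹ : ℝ) : ℂ)‖ ≤ R * ‖aCoeff h z‖ →
        z.re < -E ∧ |z.im| < 4 * h₀) :
    ∃ α₀ > 0, ∀ h ∈ Ioo (0 : ℝ) h₀, ∀ α ∈ Ioo (0 : ℝ) α₀, ∃ ζ : ℂ → ℂ,
      DifferentiableOn ℂ ζ (Metric.ball 0 R) ∧
      (∀ μ : ℂ, ‖μ‖ < R →
        (ζ μ).re < -E₀ ∧
        qDiag h (ζ μ) + ((α⁻¹ : ℝ) : ℂ) = μ * aCoeff h (ζ μ) ∧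
        (∀ z : ℂ, z.re < -E₀ → qDiag h z + ((α⁻¹ : ℝ) : ℂ) = μ * aCoeff h z → z = ζ μ)) ∧
      (∀ μ : ℝ, |μ| < R → (ζ μ).im = 0) := by
  set C := h₀ + 8 * R with hC
  have hC₀ : 0 < C := by positivity
  obtain ⟨αE, hαE, hE⟩ := hloc (E₀ + 4 * C) (by linarith)
  set B := 24 * C + 4 * E₀ with hB
  have hγ := Real.one_half_lt_eulerMascheroniConstant
  refine ⟨min αE (4 * π / (|B| + 2 * Real.eulerMascheroniConstant)),
    lt_min hαE (by positivity), fun h hh α hα => ?_⟩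
  have hA : B ≤ Real.exp (logCenter α) := le_exp_logCenter hα.1 (hα.2.trans_le (min_le_right _ _))
  have hA₀ := Real.exp_pos (logCenter α)
  have hA₁ : 24 * (h₀ + 8 * R) ≤ Real.exp (logCenter α) := by linarith
  set D := Metric.closedBall (-(Real.exp (logCenter α) : ℂ)) (Real.exp (logCenter α) / 2) with hD
  have mem_D : ∀ μ z : ℂ, ‖logCorrection h μ z‖ ≤ 1 / 4 → expMap h α μ z ∈ D := by
    intro μ z hΦ
    rw [hD, mem_closedBall_iff_norm, sub_neg_eq_add]
    exact norm_expMap_add_le hΦ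
  have small : ∀ μ : ℂ, ‖μ‖ ≤ R → ∀ z ∈ D, ‖logCorrection h μ z‖ ≤ 1 / 12 := fun μ hμ z hz =>
    norm_logCorrection_le_of_mem_closedBall hh.1 hh.2.le hμ hA₀ hA₁ hz
  have norm_le : ∀ μ ∈ Metric.ball (0 : ℂ) R, ‖μ‖ ≤ R := fun μ hμ => (mem_ball_zero_iff.1 hμ).le
  have re_neg : ∀ z ∈ D, z.re < -E₀ := fun z hz => by
    linarith [re_le_of_mem_closedBall hz]
  have unique : ∀ μ : ℂ, ‖μ‖ ≤ R → ∀ z ∈ D, ∀ w ∈ D, expMap h α μ z = z → expMap h α μ w = w →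
      z = w := by
    intro μ hμ z hz w hw hfz hfw
    have := dist_expMap_le hh.1 hh.2.le hμ hA₁ hz hw
    rw [hfz, hfw] at this
    exact dist_le_zero.1 (by linarith)
  obtain ⟨ζ, hζ, hfix⟩ := exists_differentiableOn_fixedPoint (U := Metric.ball 0 R)
    Metric.isOpen_ball (half_pos hA₀).le (expMap h α)
    (fun μ hμ z hz => mem_D μ z ((small μ (norm_le μ hμ) z hz).trans (by norm_num)))
    (fun μ hμ z hz w hw => dist_expMap_le hh.1 hh.2.le (norm_le μ hμ) hA₁ hz hw)
    (fun g hg hgD => (differentiableOn_logCorrection_comp hh.1 hg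
      fun μ hμ => by linarith [re_neg _ (hgD μ hμ)]).cexp.const_mul _)
  refine ⟨ζ, hζ, fun μ hμ => ?_, fun μ hμ => ?_⟩
  · obtain ⟨hmem, hf⟩ := hfix μ (mem_ball_zero_iff.2 hμ)
    refine ⟨re_neg _ hmem, eq_of_expMap_eq_self
      ((small μ hμ.le _ hmem).trans (by norm_num)) hf, fun z hz heq => ?_⟩
    have hzE : z.re < -(E₀ + 4 * C) :=
      (hE α ⟨hα.1, hα.2.trans_le (min_le_left _ _)⟩ h hh z hz (by
        rw [heq, norm_mul]; gcongr)).1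
    have hΦ : ‖logCorrection h μ z‖ ≤ 1 / 4 := by
      refine (norm_logCorrection_le hh.1 hh.2.le hμ.le (by linarith)).trans ?_
      rw [div_le_iff₀ (by linarith)]
      linarith
    have hfz : expMap h α μ z = z := expMap_eq_self_of_eq (by linarith) heq
    exact unique μ hμ.le z (hfz ▸ mem_D μ z hΦ) _ hmem hfz hf
  · have hμ' : ‖(μ : ℂ)‖ < R := by simpa using hμ
    obtain ⟨hmem, hf⟩ := hfix μ (mem_ball_zero_iff.2 hμ')
    have hconj : expMap h α μ (starRingEnd ℂ (ζ μ)) = starRingEnd ℂ (ζ μ) := by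
      have := expMap_conj h α μ (ζ μ)
      rwa [Complex.conj_ofReal, hf] at this
    have hmem' : starRingEnd ℂ (ζ μ) ∈ D := by
      rw [mem_closedBall_iff_norm] at hmem ⊢
      rwa [← Complex.norm_conj, map_sub, Complex.conj_conj, map_neg, Complex.conj_ofReal]
    exact Complex.conj_eq_iff_im.1 (unique μ hμ'.le _ hmem' _ hmem hconj hf)
end

section
/- There exist E₁>0 and h₀>0 such that for all h∈(0,h₀), all z∈ℂ with Re z<−E₁ and |Im z|<4h₀, and all (m,n)∈ℤ² with |m|+|n| ≥ 2, one has |F_h(√(m²+n²),z)| ≤ 2·|a(z,h)|·exp(−√(−Re z)·(√(m²+n²)−1)). (Consequently the normalized off-diagonal Fourier coefficients t(m,n) = F_h(√(m²+n²),z)/a(z,h) of the effective symbol decay exponentially in √(m²+n²), uniformly in this regime, with rate √(−Re z).) -/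
open MeasureTheory Real Set

lemma nonneg_of_hasDerivAt_nonneg {f f' : ℝ → ℝ} (hf : ∀ x, HasDerivAt f (f' x) x)
    (hf' : ∀ x, 0 < x → 0 ≤ f' x) (h0 : f 0 = 0) {x : ℝ} (hx : 0 ≤ x) : 0 ≤ f x := by
  have hmono : MonotoneOn f (Ici 0) := by
    apply monotoneOn_of_deriv_nonneg (convex_Ici 0)
    · exact fun y _ => (hf y).continuousAt.continuousWithinAt
    · exact fun y _ => (hf y).differentiableAt.differentiableWithinAt
    · intro y hy
      rw [interior_Ici] at hy
      rw [(hf y).deriv]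
      exact hf' y hy
  have := hmono (mem_Ici.2 le_rfl) (mem_Ici.2 hx) hx
  rwa [h0] at this

lemma mul_sinh_le_sinh_mul {r x : ℝ} (hr : 1 ≤ r) (hx : 0 ≤ x) :
    r * sinh x ≤ sinh (r * x) := by
  have key : 0 ≤ sinh (r * x) - r * sinh x := by
    refine nonneg_of_hasDerivAt_nonneg (f := fun x => sinh (r * x) - r * sinh x)
      (f' := fun x => cosh (r * x) * (r * 1) - r * cosh x) (fun y => ?_) (fun y hy => ?_)
      (by simp) hx
    · exact (((hasDerivAt_id y).const_mul r).sinh).sub ((hasDerivAt_sinh y).const_mul r)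
    · have : cosh y ≤ cosh (r * y) := by
        rw [cosh_le_cosh, abs_of_pos hy, abs_of_pos (by positivity)]
        nlinarith
      nlinarith
  linarith

lemma cosh_mul_sinh_mul_le {r x : ℝ} (hr : 1 ≤ r) (hx : 0 ≤ x) :
    cosh x * sinh (r * x) ≤ r * cosh (r * x) * sinh x := by
  have key : 0 ≤ r * cosh (r * x) * sinh x - cosh x * sinh (r * x) := by
    refine nonneg_of_hasDerivAt_nonneg
      (f := fun x => r * cosh (r * x) * sinh x - cosh x * sinh (r * x))
      (f' := fun x => (r * (sinh (r * x) * (r * 1)) * sinh x + r * cosh (r * x) * cosh x)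
        - (sinh x * sinh (r * x) + cosh x * (cosh (r * x) * (r * 1))))
      (fun y => ?_) (fun y hy => ?_) (by simp) hx
    · have h1 := (hasDerivAt_id y).const_mul r
      exact ((h1.cosh.const_mul r).mul (hasDerivAt_sinh y)).sub
        ((hasDerivAt_cosh y).mul h1.sinh)
    · have h1 : 0 < sinh y := sinh_pos_iff.2 hy
      have h2 : 0 < sinh (r * y) := sinh_pos_iff.2 (by positivity)
      have h3 : 0 ≤ (r ^ 2 - 1) * (sinh y * sinh (r * y)) :=
        mul_nonneg (by nlinarith) (by positivity)
      nlinarith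
  linarith

lemma sinh_le_mul_cosh {x : ℝ} (hx : 0 ≤ x) : sinh x ≤ x * cosh x := by
  have key : 0 ≤ x * cosh x - sinh x := by
    refine nonneg_of_hasDerivAt_nonneg (f := fun x => x * cosh x - sinh x)
      (f' := fun x => (1 * cosh x + x * sinh x) - cosh x) (fun y => ?_) (fun y hy => ?_)
      (by simp) hx
    · exact ((hasDerivAt_id y).mul (hasDerivAt_cosh y)).sub (hasDerivAt_sinh y)
    · have h1 : 0 < sinh y := sinh_pos_iff.2 hy
      have : 0 < y * sinh y := by positivity
      linarith
  linarith

lemma mul_cosh_le_one_add_mul_sinh {x : ℝ} (hx : 0 ≤ x) :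
    x * cosh x ≤ (1 + x) * sinh x := by
  have key : 0 ≤ (1 + x) * sinh x - x * cosh x := by
    refine nonneg_of_hasDerivAt_nonneg (f := fun x => (1 + x) * sinh x - x * cosh x)
      (f' := fun x => (1 * sinh x + (1 + x) * cosh x) - (1 * cosh x + x * sinh x))
      (fun y => ?_) (fun y hy => ?_) (by simp) hx
    · exact ((((hasDerivAt_id y).const_add 1)).mul (hasDerivAt_sinh y)).sub
        ((hasDerivAt_id y).mul (hasDerivAt_cosh y))
    · have h1 : 0 < sinh y := sinh_pos_iff.2 hy
      have h2 : sinh y < cosh y := sinh_lt_cosh y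
      nlinarith [mul_pos hy (sub_pos.2 h2)]
  linarith

lemma landauHeatKernel_nonneg {h t : ℝ} (r : ℝ) (hh : 0 < h) (ht : 0 < t) :
    0 ≤ landauHeatKernel h r t := by
  have h1 : 0 < sinh (h * t) := sinh_pos_iff.2 (by positivity)
  unfold landauHeatKernel
  positivity

lemma inv_le_mul_coth {h t : ℝ} (hh : 0 < h) (ht : 0 < t) :
    1 / t ≤ h * (cosh (h * t) / sinh (h * t)) := by
  have h1 : 0 < sinh (h * t) := sinh_pos_iff.2 (by positivity)
  have h2 := sinh_le_mul_cosh (x := h * t) (by positivity)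
  rw [← mul_div_assoc, div_le_div_iff₀ ht h1]
  linarith

lemma mul_coth_le_inv_add {h t : ℝ} (hh : 0 < h) (ht : 0 < t) :
    h * (cosh (h * t) / sinh (h * t)) ≤ 1 / t + h := by
  have h1 : 0 < sinh (h * t) := sinh_pos_iff.2 (by positivity)
  have h2 := mul_cosh_le_one_add_mul_sinh (x := h * t) (by positivity)
  have h3 : 1 / t + h = (1 + h * t) / t := by field_simp
  rw [← mul_div_assoc, h3, div_le_div_iff₀ h1 ht]
  linarith

/-- Scaling time by `r` bounds the heat kernel at distance `r` by the one at distance `1`. -/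
lemma mul_exp_mul_landauHeatKernel_le {h r t E : ℝ} (hh : 0 < h) (hr : 1 ≤ r) (ht : 0 < t)
    (hE : 0 ≤ E) :
    r * (exp (-E * (r * t)) * landauHeatKernel h r (r * t)) ≤
      exp (-√E * (r - 1)) * (exp (-E * t) * landauHeatKernel h 1 t) := by
  have hr0 : 0 < r := by linarith
  have hs : 0 < sinh (h * t) := sinh_pos_iff.2 (by positivity)
  have hsr : 0 < sinh (h * (r * t)) := sinh_pos_iff.2 (by positivity)
  have e : r * (h * t) = h * (r * t) := by ring
  have h1 := mul_sinh_le_sinh_mul (x := h * t) hr (by positivity)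
  have h2 := cosh_mul_sinh_mul_le (x := h * t) hr (by positivity)
  rw [e] at h1 h2
  have hw : r * (h / (4 * π * sinh (h * (r * t)))) ≤ h / (4 * π * sinh (h * t)) := by
    rw [← mul_div_assoc, div_le_div_iff₀ (by positivity) (by positivity)]
    have : 0 < h * (4 * π) := by positivity
    nlinarith
  have hc : cosh (h * t) / sinh (h * t) ≤ r * (cosh (h * (r * t)) / sinh (h * (r * t))) := by
    rw [← mul_div_assoc, div_le_div_iff₀ hs hsr]
    exact h2
  have hg := inv_le_mul_coth hh ht
  set c := cosh (h * t) / sinh (h * t)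
  set c' := cosh (h * (r * t)) / sinh (h * (r * t))
  have hk : √E ≤ E * t + h * c / 4 := by
    have hsq : √E ^ 2 = E := Real.sq_sqrt hE
    have h3 : √E ≤ E * t + (1 / t) / 4 := by
      have : E * t + (1 / t) / 4 - √E = (2 * √E * t - 1) ^ 2 / (4 * t) := by
        field_simp
        rw [← hsq, Real.sqrt_sq (Real.sqrt_nonneg E)]
        ring
      have : 0 ≤ (2 * √E * t - 1) ^ 2 / (4 * t) := by positivity
      linarith
    linarith
  have hexp : -E * (r * t) + -(h * r ^ 2 * c') / 4 ≤
      -√E * (r - 1) + (-E * t + -(h * 1 ^ 2 * c) / 4) := by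
    have h4 : h * r * c ≤ h * r * (r * c') :=
      mul_le_mul_of_nonneg_left hc (by positivity)
    have h5 := mul_le_mul_of_nonneg_left hk (sub_nonneg.2 hr)
    nlinarith
  unfold landauHeatKernel
  calc r * (exp (-E * (r * t)) * (h / (4 * π * sinh (h * (r * t))) *
        exp (-(h * r ^ 2 * c') / 4)))
      = r * (h / (4 * π * sinh (h * (r * t)))) *
          exp (-E * (r * t) + -(h * r ^ 2 * c') / 4) := by rw [exp_add]; ring
    _ ≤ h / (4 * π * sinh (h * t)) *
          exp (-√E * (r - 1) + (-E * t + -(h * 1 ^ 2 * c) / 4)) := by gcongr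
    _ = _ := by rw [exp_add, exp_add]; ring

lemma landauHeatKernel_one_le {h t : ℝ} (hh : 0 < h) (ht : 0 < t) :
    landauHeatKernel h 1 t ≤ 1 / π := by
  have hs : 0 < sinh (h * t) := sinh_pos_iff.2 (by positivity)
  have hs' : h * t ≤ sinh (h * t) := self_le_sinh_iff.2 (by positivity)
  have hg := inv_le_mul_coth hh ht
  unfold landauHeatKernel
  have h1 : h / (4 * π * sinh (h * t)) ≤ 1 / (4 * π * t) := by
    rw [div_le_div_iff₀ (by positivity) (by positivity)]
    have : 0 < 4 * π := by positivity
    nlinarith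
  have h2 : exp (-(h * 1 ^ 2 * (cosh (h * t) / sinh (h * t))) / 4) ≤ 4 * t := by
    calc _ ≤ exp (-(1 / (4 * t))) := by
          apply exp_le_exp.2
          have : 1 / (4 * t) = 1 / t / 4 := by field_simp
          linarith
      _ ≤ 4 * t := by
          rw [exp_neg, inv_le_comm₀ (exp_pos _) (by positivity)]
          have := add_one_le_exp (1 / (4 * t))
          rw [← one_div]
          linarith
  calc _ ≤ 1 / (4 * π * t) * (4 * t) := by gcongr
    _ = 1 / π := by field_simp

lemma integrableOn_exp_mul_landauHeatKernel {h E : ℝ} (hh : 0 < h) (hE : 0 < E) :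
    IntegrableOn (fun t => exp (-E * t) * landauHeatKernel h 1 t) (Ioi 0) := by
  have hi : IntegrableOn (fun t => exp (-E * t) * (1 / π)) (Ioi 0) :=
    (integrableOn_exp_mul_Ioi (neg_neg_of_pos hE) 0).mul_const _
  refine hi.mono' ?_ ?_
  · exact (Measurable.mul (by fun_prop) (measurable_landauHeatKernel h 1)).aestronglyMeasurable
  · refine (ae_restrict_iff' measurableSet_Ioi).2 (.of_forall fun t ht => ?_)
    have h0 := landauHeatKernel_nonneg 1 hh ht
    rw [Real.norm_of_nonneg (by positivity)]
    exact mul_le_mul_of_nonneg_left (landauHeatKernel_one_le hh ht) (exp_pos _).le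

lemma norm_exp_mul_landauHeatKernel {h t : ℝ} (r : ℝ) (z : ℂ) (hh : 0 < h) (ht : 0 < t) :
    ‖Complex.exp (z * t) * ((landauHeatKernel h r t : ℝ) : ℂ)‖ =
      exp (-(-z.re) * t) * landauHeatKernel h r t := by
  rw [norm_mul, Complex.norm_exp, Complex.norm_real,
    Real.norm_of_nonneg (landauHeatKernel_nonneg r hh ht)]
  simp

lemma norm_landauGreen_le {h r : ℝ} {z : ℂ} (hh : 0 < h) (hr : 1 ≤ r) (hz : z.re < 0) :
    ‖landauGreen h r z‖ ≤ exp (-√(-z.re) * (r - 1)) *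
      ∫ t in Ioi (0 : ℝ), exp (-(-z.re) * t) * landauHeatKernel h 1 t := by
  have hr0 : 0 < r := by linarith
  calc ‖landauGreen h r z‖
      ≤ ∫ t in Ioi (0 : ℝ), ‖Complex.exp (z * t) * ((landauHeatKernel h r t : ℝ) : ℂ)‖ :=
        norm_integral_le_integral_norm _
    _ = ∫ t in Ioi (0 : ℝ), exp (-(-z.re) * t) * landauHeatKernel h r t :=
        setIntegral_congr_fun measurableSet_Ioi
          fun t ht => norm_exp_mul_landauHeatKernel r z hh ht
    _ = ∫ t in Ioi (0 : ℝ),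
          r * (exp (-(-z.re) * (r * t)) * landauHeatKernel h r (r * t)) := by
        have := integral_comp_mul_left_Ioi
          (fun t => exp (-(-z.re) * t) * landauHeatKernel h r t) 0 hr0
        rw [integral_const_mul, this, mul_zero, smul_eq_mul, mul_inv_cancel_left₀ hr0.ne']
    _ ≤ ∫ t in Ioi (0 : ℝ), exp (-√(-z.re) * (r - 1)) *
          (exp (-(-z.re) * t) * landauHeatKernel h 1 t) := by
        refine integral_mono_of_nonneg ?_
          ((integrableOn_exp_mul_landauHeatKernel hh (by linarith)).const_mul _) ?_
        · refine (ae_restrict_iff' measurableSet_Ioi).2 (.of_forall fun t ht => ?_)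
          have ht0 : 0 < t := ht
          have := landauHeatKernel_nonneg r hh (t := r * t) (by positivity)
          simp only [Pi.zero_apply]
          positivity
        · exact (ae_restrict_iff' measurableSet_Ioi).2 (.of_forall fun t ht =>
            mul_exp_mul_landauHeatKernel_le hh hr ht (by linarith))
    _ = _ := integral_const_mul _ _

lemma exp_mul_landauHeatKernel_add_one_le {h t E : ℝ} (hh : 0 < h) (hh1 : h ≤ 1)
    (ht : 1 ≤ t) (hE : 6 ≤ E) :
    exp (-E * (t + 1)) * landauHeatKernel h 1 (t + 1) ≤
      1 / 6 * (exp (-E * t) * landauHeatKernel h 1 t) := by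
  have ht0 : 0 < t := by linarith
  have hs : 0 < sinh (h * t) := sinh_pos_iff.2 (by positivity)
  have hs1 : sinh (h * t) ≤ sinh (h * (t + 1)) := sinh_le_sinh.2 (by nlinarith)
  have hs2 : 0 < sinh (h * (t + 1)) := hs.trans_le hs1
  have hg : h * (cosh (h * t) / sinh (h * t)) ≤ 2 := by
    have h1 := mul_coth_le_inv_add hh ht0
    have h2 : 1 / t ≤ 1 := by rw [div_le_one ht0]; exact ht
    linarith
  have hg' : 0 ≤ h * (cosh (h * (t + 1)) / sinh (h * (t + 1))) := by
    have := cosh_pos (h * (t + 1))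
    positivity
  have h6 : exp (-5) ≤ 1 / 6 := by
    rw [exp_neg, ← one_div]
    exact one_div_le_one_div_of_le (by norm_num) (by linarith [add_one_le_exp (5 : ℝ)])
  unfold landauHeatKernel
  calc exp (-E * (t + 1)) * (h / (4 * π * sinh (h * (t + 1))) *
        exp (-(h * 1 ^ 2 * (cosh (h * (t + 1)) / sinh (h * (t + 1)))) / 4))
      = h / (4 * π * sinh (h * (t + 1))) * exp (-E * (t + 1) +
          -(h * 1 ^ 2 * (cosh (h * (t + 1)) / sinh (h * (t + 1)))) / 4) := by
        rw [exp_add]; ring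
    _ ≤ h / (4 * π * sinh (h * t)) * exp (-5 + (-E * t +
          -(h * 1 ^ 2 * (cosh (h * t) / sinh (h * t))) / 4)) := by
        gcongr ?_ * exp ?_
        · gcongr
        · linarith
    _ = exp (-5) * (exp (-E * t) * (h / (4 * π * sinh (h * t)) *
          exp (-(h * 1 ^ 2 * (cosh (h * t) / sinh (h * t))) / 4))) := by
        rw [exp_add, exp_add]; ring
    _ ≤ _ := by gcongr

lemma setIntegral_Ioi_two_exp_mul_landauHeatKernel_le {h E : ℝ} (hh : 0 < h) (hh1 : h ≤ 1)
    (hE : 6 ≤ E) :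
    ∫ t in Ioi (2 : ℝ), exp (-E * t) * landauHeatKernel h 1 t ≤
      1 / 6 * ∫ t in Ioi (0 : ℝ), exp (-E * t) * landauHeatKernel h 1 t := by
  have hint := integrableOn_exp_mul_landauHeatKernel hh (E := E) (by linarith)
  have hsub : Ioi (1 : ℝ) ⊆ Ioi 0 := Ioi_subset_Ioi zero_le_one
  calc ∫ t in Ioi (2 : ℝ), exp (-E * t) * landauHeatKernel h 1 t
      = ∫ t in Ioi (1 : ℝ), exp (-E * (t + 1)) * landauHeatKernel h 1 (t + 1) := by
        have := (measurePreserving_add_right volume (1 : ℝ)).setIntegral_preimage_emb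
          (measurableEmbedding_addRight 1)
          (fun t => exp (-E * t) * landauHeatKernel h 1 t) (Ioi 2)
        rw [← this]
        norm_num
    _ ≤ ∫ t in Ioi (1 : ℝ), 1 / 6 * (exp (-E * t) * landauHeatKernel h 1 t) := by
        refine integral_mono_of_nonneg ?_ ((hint.mono_set hsub).const_mul _) ?_
        · refine (ae_restrict_iff' measurableSet_Ioi).2 (.of_forall fun t ht => ?_)
          have ht0 : (1 : ℝ) < t := ht
          have := landauHeatKernel_nonneg 1 hh (t := t + 1) (by linarith)
          simp only [Pi.zero_apply]
          positivity
        · exact (ae_restrict_iff' measurableSet_Ioi).2 (.of_forall fun t ht =>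
            exp_mul_landauHeatKernel_add_one_le hh hh1 (le_of_lt ht) hE)
    _ = 1 / 6 * ∫ t in Ioi (1 : ℝ), exp (-E * t) * landauHeatKernel h 1 t :=
        integral_const_mul _ _
    _ ≤ _ := by
        refine mul_le_mul_of_nonneg_left (setIntegral_mono_set hint ?_ hsub.eventuallyLE)
          (by norm_num)
        refine (ae_restrict_iff' measurableSet_Ioi).2 (.of_forall fun t ht => ?_)
        exact mul_nonneg (exp_pos _).le (landauHeatKernel_nonneg 1 hh ht)

lemma integral_le_four_mul_norm_landauGreen {h : ℝ} {z : ℂ} (hh : 0 < h) (hh1 : h ≤ 1)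
    (hre : z.re < -6) (him : |z.im| ≤ 1 / 2) :
    ∫ t in Ioi (0 : ℝ), exp (-(-z.re) * t) * landauHeatKernel h 1 t ≤
      4 * ‖landauGreen h 1 z‖ := by
  have hint := integrableOn_exp_mul_landauHeatKernel hh (E := -z.re) (by linarith)
  have htail := setIntegral_Ioi_two_exp_mul_landauHeatKernel_le hh hh1 (E := -z.re)
    (by linarith)
  set f : ℝ → ℝ := fun t => exp (-(-z.re) * t) * landauHeatKernel h 1 t
  set g : ℝ → ℂ := fun t => Complex.exp (z * t) * ((landauHeatKernel h 1 t : ℝ) : ℂ)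
  have hg : IntegrableOn g (Ioi 0) := by
    refine hint.mono' ?_ ?_
    · exact (Measurable.mul (by fun_prop)
        (Complex.measurable_ofReal.comp (measurable_landauHeatKernel h 1))).aestronglyMeasurable
    · exact (ae_restrict_iff' measurableSet_Ioi).2 (.of_forall fun t ht =>
        (norm_exp_mul_landauHeatKernel 1 z hh ht).le)
  have hre_eq : ∀ t, (g t).re = cos (z.im * t) * f t := by
    intro t
    simp only [g, f, Complex.re_mul_ofReal, Complex.exp_re]
    simp
    ring
  have hind : IntegrableOn ((Ioi (2 : ℝ)).indicator f) (Ioi 0) :=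
    hint.indicator measurableSet_Ioi
  have hlow : ∫ t in Ioi (0 : ℝ), (1 / 2 * f t - 3 / 2 * (Ioi (2 : ℝ)).indicator f t) ≤
      ∫ t in Ioi (0 : ℝ), (g t).re := by
    refine setIntegral_mono_on ((hint.const_mul _).sub (hind.const_mul _)) hg.re
      measurableSet_Ioi fun t ht => ?_
    have ht0 : (0 : ℝ) < t := ht
    have hf : 0 ≤ f t := mul_nonneg (exp_pos _).le (landauHeatKernel_nonneg 1 hh ht)
    rw [hre_eq]
    by_cases h2 : 2 < t
    · rw [indicator_of_mem (mem_Ioi.2 h2)]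
      nlinarith [neg_one_le_cos (z.im * t)]
    · rw [indicator_of_notMem (by simpa using h2)]
      have hc : 1 / 2 ≤ cos (z.im * t) := by
        have h3 := one_sub_sq_div_two_le_cos (x := z.im * t)
        have h4 : |z.im * t| ≤ 1 := by
          rw [abs_mul, abs_of_pos ht0]
          nlinarith [abs_nonneg z.im]
        have h5 := (sq_le_one_iff_abs_le_one _).2 h4
        linarith
      nlinarith
  rw [integral_sub (hint.const_mul _) (hind.const_mul _), integral_const_mul,
    integral_const_mul, setIntegral_indicator measurableSet_Ioi,
    inter_eq_self_of_subset_right (Ioi_subset_Ioi (by norm_num : (0 : ℝ) ≤ 2))] at hlow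
  have hcomm : ∫ t in Ioi (0 : ℝ), (g t).re = (landauGreen h 1 z).re :=
    Complex.reCLM.integral_comp_comm hg
  have hnorm := Complex.re_le_norm (landauGreen h 1 z)
  rw [hcomm] at hlow
  linarith

/-- There exist `E₁>0` and `h₀>0` such that for `h∈(0,h₀)`, `Re z<−E₁`, `|Im z|<4h₀`
and all `(m,n)∈ℤ²` with `|m|+|n|≥2`:
`|F_h(√(m²+n²),z)| ≤ 2 |a(z,h)| exp(−√(−Re z)(√(m²+n²)−1))`. -/
theorem effective_symbol_coefficient_decay :
    ∃ E₁ > 0, ∃ h₀ > 0, ∀ h ∈ Ioo (0 : ℝ) h₀, ∀ z : ℂ,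
      z.re < -E₁ → |z.im| < 4 * h₀ → ∀ m n : ℤ, 2 ≤ |m| + |n| →
      ‖landauGreen h (Real.sqrt ((m : ℝ) ^ 2 + (n : ℝ) ^ 2)) z‖ ≤
        2 * ‖aCoeff h z‖ *
          Real.exp (-Real.sqrt (-z.re) * (Real.sqrt ((m : ℝ) ^ 2 + (n : ℝ) ^ 2) - 1)) := by
  refine ⟨6, by norm_num, 1 / 8, by norm_num, fun h hh z hre him m n hmn => ?_⟩
  have hr : 1 ≤ √((m : ℝ) ^ 2 + (n : ℝ) ^ 2) := by
    rw [Real.one_le_sqrt]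
    have h1 : 1 ≤ m ^ 2 + n ^ 2 := by
      rw [← sq_abs m, ← sq_abs n]
      nlinarith [sq_nonneg (|m| - |n|)]
    exact_mod_cast h1
  have hup := norm_landauGreen_le hh.1 hr (z := z) (by linarith)
  have hlow := integral_le_four_mul_norm_landauGreen hh.1 (by linarith [hh.2]) hre
    (by linarith)
  have ha : ‖aCoeff h z‖ = 2 * ‖landauGreen h 1 z‖ := by
    simp [aCoeff]
  refine hup.trans ((mul_le_mul_of_nonneg_left hlow (exp_pos _).le).trans_eq ?_)
  rw [ha]
  ring
end
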